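/- Let B be a finite-dimensional Iwanaga–Gorenstein algebra and let M, N be projectively Cohen–Macaulay B-modules (Ext^i_B(M,B) = Ext^i_B(N,B) = 0 for all i > 0), with N = Ω X for some module X with projective cover P, giving a short exact sequence 0 → N → P → X → 0. Then Ext¹_B(M,N) ≠ 0 if and only if there exists a morphism M → X that does not factor through a projective module. -/

import Mathlib

open CategoryTheory

/-- There exists a nonsplit short exact sequence `0 → N → E → M → 0`;
equivalently, `Ext¹_B(M, N) ≠ 0`. -/
def HasNonsplitExt (B : Type) [Ring B] (N M : Type) [AddCommGroup N] [Module B N]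
    [AddCommGroup M] [Module B M] : Prop :=
  ∃ (E : ModuleCat.{0} B) (ι : N →ₗ[B] E) (π : E →ₗ[B] M),
    Function.Injective ι ∧ Function.Surjective π ∧
      LinearMap.range ι = LinearMap.ker π ∧
      ¬ ∃ σ : M →ₗ[B] E, π.comp σ = LinearMap.id

/-- Over a finite-dimensional algebra, the inclusion of a direct sum of copies of the regular
module into the direct product splits. -/
lemma exists_leftInverse_finsupp_lcoeFun (𝕜 B I : Type*) [Field 𝕜] [Ring B] [Algebra 𝕜 B]
    [FiniteDimensional 𝕜 B] :
    ∃ ρ : (I → B) →ₗ[B] (I →₀ B), ∀ x : I →₀ B, ρ x = x := by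
  obtain ⟨r, hr⟩ := (Finsupp.lcoeFun : (I →₀ 𝕜) →ₗ[𝕜] (I → 𝕜)).exists_leftInverse_of_injective
    (LinearMap.ker_eq_bot.2 DFunLike.coe_injective)
  let b := Module.finBasis 𝕜 B
  let c (j) (x : I → B) : I → 𝕜 := fun i ↦ b.coord j (x i)
  have hc (j) (a : B) (x : I → B) :
      c j (a • x) = ∑ l, b.coord j (a * b l) • c l x := by
    ext i
    have : a * x i = ∑ l, b.coord l (x i) • (a * b l) := by
      conv_lhs => rw [← b.sum_repr (x i)]
      simp [Finset.mul_sum, -Module.Basis.sum_repr]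
    simp [c, this, -Module.Basis.coord_apply, mul_comm]
  refine ⟨{ toFun := fun x ↦ ∑ j, (r (c j x)).mapRange (fun t ↦ t • b j) (zero_smul _ _)
            map_add' := fun x y ↦ ?_
            map_smul' := fun a x ↦ ?_ }, fun x ↦ ?_⟩
  · have key (j) : c j (x + y) = c j x + c j y := by ext; simp [c]
    ext i
    simp [key, add_smul, Finset.sum_add_distrib, Finsupp.finsetSum_apply]
  · ext i
    have key (l) : a * b l = ∑ j, b.coord j (a * b l) • b j := (b.sum_repr _).symm
    simp only [hc, map_sum, map_smul, Finsupp.finsetSum_apply, Finsupp.mapRange_apply,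
      Finsupp.smul_apply, RingHom.id_apply, smul_eq_mul, Finset.mul_sum, Finset.sum_smul,
      mul_smul_comm]
    rw [Finset.sum_comm]
    refine Finset.sum_congr rfl fun l _ ↦ ?_
    conv_rhs => rw [key l, Finset.smul_sum]
    exact Finset.sum_congr rfl fun j _ ↦ by rw [mul_comm, mul_smul]
  · have key (j) : r (c j x) = x.mapRange (b.coord j) (map_zero _) :=
      DFunLike.congr_fun hr (x.mapRange (b.coord j) (map_zero _))
    ext i
    simp [key, Finsupp.finsetSum_apply, b.sum_repr]

/-- If `Ext¹(M, Y) = 0`, then maps into `Y` extend along the inclusion in a short exact sequence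
with cokernel `M`. -/
lemma exists_extension_of_subsingleton_ext {B : Type} [Ring B] [HasExt.{0} (ModuleCat.{0} B)]
    {N E M Y : Type} [AddCommGroup N] [Module B N] [AddCommGroup E] [Module B E]
    [AddCommGroup M] [Module B M] [AddCommGroup Y] [Module B Y]
    (hY : Subsingleton (Abelian.Ext (ModuleCat.of B M) (ModuleCat.of B Y) 1))
    {i : N →ₗ[B] E} {p : E →ₗ[B] M} (hi : Function.Injective i) (hp : Function.Surjective p)
    (hip : Function.Exact i p) (φ : N →ₗ[B] Y) : ∃ ψ : E →ₗ[B] Y, ψ ∘ₗ i = φ := by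
  let S : ShortComplex (ModuleCat.{0} B) :=
    ShortComplex.mk (ModuleCat.ofHom i) (ModuleCat.ofHom p)
      (by ext x; exact hip.apply_apply_eq_zero x)
  have hS : S.ShortExact := ModuleCat.shortComplex_shortExact S hip hi hp
  obtain ⟨y, hy⟩ := Abelian.Ext.contravariant_sequence_exact₁ hS (ModuleCat.of B Y)
    (Abelian.Ext.mk₀ (ModuleCat.ofHom φ)) (add_zero 1) (hY.elim _ _)
  obtain ⟨ψ, rfl⟩ := Abelian.Ext.homEquiv₀.symm.surjective y
  refine ⟨ψ.hom, ?_⟩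
  have h : S.f ≫ ψ = ModuleCat.ofHom φ :=
    Abelian.Ext.homEquiv₀.symm.injective ((Abelian.Ext.mk₀_comp_mk₀ _ _).symm.trans hy)
  exact congr_arg ModuleCat.Hom.hom h

/-- Over a finite-dimensional algebra, a map that lets every map into the regular module extend
lets every map into a projective module extend. -/
lemma exists_extension_of_projective (𝕜 : Type*) {B N E P : Type*} [Field 𝕜] [Ring B]
    [Algebra 𝕜 B] [FiniteDimensional 𝕜 B] [AddCommGroup N] [Module B N] [AddCommGroup E]
    [Module B E] [AddCommGroup P] [Module B P] [Module.Projective B P] (i : N →ₗ[B] E)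
    (hi : ∀ φ : N →ₗ[B] B, ∃ ψ : E →ₗ[B] B, ψ ∘ₗ i = φ) (φ : N →ₗ[B] P) :
    ∃ ψ : E →ₗ[B] P, ψ ∘ₗ i = φ := by
  obtain ⟨ρ, hρ⟩ := exists_leftInverse_finsupp_lcoeFun 𝕜 B P
  obtain ⟨s, hs⟩ := Module.projective_def.1 ‹Module.Projective B P›
  choose ψ hψ using fun j ↦ hi (Finsupp.lapply j ∘ₗ s ∘ₗ φ)
  refine ⟨Finsupp.linearCombination B id ∘ₗ ρ ∘ₗ LinearMap.pi ψ, LinearMap.ext fun x ↦ ?_⟩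
  have h : LinearMap.pi ψ (i x) = s (φ x) := funext fun j ↦ LinearMap.congr_fun (hψ j) x
  simp [h, hρ, hs (φ x)]

/-- If `f` does not lift through `π`, then the pullback along `f` of the extension given by `π`
is nonsplit. -/
lemma hasNonsplitExt_of_not_exists_lift {B N M X P : Type} [Ring B] [AddCommGroup M] [Module B M]
    [AddCommGroup N] [Module B N] [AddCommGroup X] [Module B X] [AddCommGroup P] [Module B P]
    {ι : N →ₗ[B] P} {π : P →ₗ[B] X} (hι : Function.Injective ι) (hπ : Function.Surjective π)
    (hexact : Function.Exact ι π) {f : M →ₗ[B] X} (hf : ¬ ∃ g : M →ₗ[B] P, π ∘ₗ g = f) :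
    HasNonsplitExt B N M := by
  let E : Submodule B (M × P) := LinearMap.eqLocus (f ∘ₗ .fst B M P) (π ∘ₗ .snd B M P)
  refine ⟨ModuleCat.of B E, (LinearMap.inr B M P ∘ₗ ι).codRestrict E fun n ↦ ?_,
    .fst B M P ∘ₗ E.subtype, fun x y h ↦ ?_, fun m ↦ ?_, ?_, ?_⟩
  · simp [E, hexact.apply_apply_eq_zero n]
  · exact hι (congr_arg (fun e : E ↦ e.1.2) h)
  · obtain ⟨p, hp⟩ := hπ (f m)
    exact ⟨⟨(m, p), hp.symm⟩, rfl⟩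
  · refine le_antisymm ?_ ?_
    · rintro _ ⟨n, rfl⟩
      rfl
    · rintro ⟨⟨m, p⟩, h⟩ (rfl : m = 0)
      obtain ⟨n, rfl⟩ := (hexact p).1 (h.symm.trans (map_zero f))
      exact ⟨n, rfl⟩
  · rintro ⟨σ, hσ⟩
    refine hf ⟨.snd B M P ∘ₗ E.subtype ∘ₗ σ, LinearMap.ext fun m ↦ ?_⟩
    exact (σ m).2.symm.trans (congr_arg f (LinearMap.congr_fun hσ m))

/-- If `ι` extends to a map `e` on the middle term of an extension, and the map on cokernels
induced by `e` lifts through `π`, then the extension splits. -/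
lemma exists_section_of_lift {B N E M X P : Type*} [Ring B] [AddCommGroup M] [Module B M]
    [AddCommGroup N] [Module B N] [AddCommGroup E] [Module B E] [AddCommGroup X] [Module B X]
    [AddCommGroup P] [Module B P] {ι : N →ₗ[B] P} {π : P →ₗ[B] X} {i : N →ₗ[B] E}
    {p : E →ₗ[B] M} (hι : Function.Injective ι) (hexact : Function.Exact ι π)
    (hi : Function.Injective i) (hp : Function.Surjective p) (hip : Function.Exact i p)
    {e : E →ₗ[B] P} (he : e ∘ₗ i = ι) {t : M →ₗ[B] P} (ht : π ∘ₗ t ∘ₗ p = π ∘ₗ e) :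
    ∃ σ : M →ₗ[B] E, p ∘ₗ σ = LinearMap.id := by
  have hd (x : E) : (e - t ∘ₗ p) x ∈ LinearMap.range ι :=
    (hexact _).1 (by simpa [sub_eq_zero] using (LinearMap.congr_fun ht x).symm)
  refine ((hip.split_tfae hi hp).out 0 1 rfl rfl).2
    ⟨(LinearEquiv.ofInjective ι hι).symm ∘ₗ (e - t ∘ₗ p).codRestrict _ hd,
      LinearMap.ext fun n ↦ (LinearEquiv.ofInjective ι hι).symm_apply_eq.2 (Subtype.ext ?_)⟩
  simpa [hip.apply_apply_eq_zero n] using LinearMap.congr_fun he n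

/-- Let `B` be a finite-dimensional Iwanaga–Gorenstein algebra, i.e. `B` has finite
self-injective dimension as a left and as a right module over itself (equivalently,
there is an `n` such that `Ext^i(−, B)` vanishes for `i > n`, on both sides).  Let
`M`, `N` be projectively Cohen–Macaulay `B`-modules, i.e.
`Ext^i_B(M,B) = Ext^i_B(N,B) = 0` for all `i > 0`, and suppose `N = Ω X` is a syzygy
of a module `X`: there is a short exact sequence `0 → N →ι P →π X → 0` where
`π : P → X` is a projective cover.  Then `Ext¹_B(M,N) ≠ 0` if and only if there
exists a morphism `M → X` that does not factor through a projective module. -/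
theorem ext_nonzero_iff_exists_nonfactoring_map
    (𝕜 B : Type) [Field 𝕜] [Ring B] [Algebra 𝕜 B] [FiniteDimensional 𝕜 B]
    [HasExt.{0} (ModuleCat B)] [HasExt.{0} (ModuleCat Bᵐᵒᵖ)]
    (hIG₁ : ∃ n : ℕ, ∀ (M : ModuleCat.{0} B) (i : ℕ), n < i →
      Subsingleton (Abelian.Ext M (ModuleCat.of B B) i))
    (hIG₂ : ∃ n : ℕ, ∀ (M : ModuleCat.{0} Bᵐᵒᵖ) (i : ℕ), n < i →
      Subsingleton (Abelian.Ext M (ModuleCat.of Bᵐᵒᵖ Bᵐᵒᵖ) i))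
    (M N X P : Type) [AddCommGroup M] [Module B M] [AddCommGroup N] [Module B N]
    [AddCommGroup X] [Module B X] [AddCommGroup P] [Module B P]
    (hMCM : ∀ i : ℕ, 0 < i →
      Subsingleton (Abelian.Ext (ModuleCat.of B M) (ModuleCat.of B B) i))
    (hNCM : ∀ i : ℕ, 0 < i →
      Subsingleton (Abelian.Ext (ModuleCat.of B N) (ModuleCat.of B B) i))
    (hP : Module.Projective B P)
    (ι : N →ₗ[B] P) (π : P →ₗ[B] X)
    (hι : Function.Injective ι) (hπ : Function.Surjective π)
    (hexact : LinearMap.range ι = LinearMap.ker π)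
    (hcover : ∀ K : Submodule B P, K ⊔ LinearMap.ker π = ⊤ → K = ⊤) :
    HasNonsplitExt B N M ↔
      ∃ f : M →ₗ[B] X, ¬ ∃ (P' : ModuleCat.{0} B) (g : M →ₗ[B] P') (h : P' →ₗ[B] X),
        Module.Projective B P' ∧ h.comp g = f := by
  have hex : Function.Exact ι π := LinearMap.exact_iff.2 hexact.symm
  constructor
  · rintro ⟨E, i, p, hi, hp, hip, hns⟩
    have hip' : Function.Exact i p := LinearMap.exact_iff.2 hip.symm
    obtain ⟨e, he⟩ := exists_extension_of_projective 𝕜 i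
      (exists_extension_of_subsingleton_ext (hMCM 1 one_pos) hi hp hip') ι
    have hker : LinearMap.ker p ≤ LinearMap.ker (π ∘ₗ e) := by
      rw [← hip]
      rintro _ ⟨n, rfl⟩
      exact (congr_arg π (LinearMap.congr_fun he n)).trans (hex.apply_apply_eq_zero n)
    let q := p.quotKerEquivOfSurjective hp
    refine ⟨(LinearMap.ker p).liftQ (π ∘ₗ e) hker ∘ₗ q.symm, ?_⟩
    rintro ⟨P', g, h, hP', hgh⟩
    obtain ⟨h', rfl⟩ := Module.projective_lifting_property π h hπ
    refine hns (exists_section_of_lift (t := h' ∘ₗ g) hι hex hi hp hip' he ?_)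
    ext x
    have hx : q.symm (p x) = (LinearMap.ker p).mkQ x := q.symm_apply_eq.2 rfl
    exact (LinearMap.congr_fun hgh (p x)).trans (by simp [hx])
  · rintro ⟨f, hf⟩
    refine hasNonsplitExt_of_not_exists_lift (f := f) hι hπ hex ?_
    rintro ⟨g, hg⟩
    exact hf ⟨ModuleCat.of B P, g, π, hP, hg⟩
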